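/- Let T > 0 and let φ : (-∞,T] → E be strongly measurable, continuous on [0,T], and such that (φ_0, φ(0)) ∈ ℬ. Then the map t ↦ (φ_t, φ(t)) is continuous from [0,T] into (ℬ, ‖·‖_ℬ); in particular, for every t ∈ [0,T], lim_{t'→t, t'∈[0,T]} ∫_{-∞}^0 g(θ)‖φ(t'+θ) - φ(t+θ)‖^p dθ = 0. -/

import Mathlib

open MeasureTheory Set Filter Topology

/-- the weighted measure `g dθ` on `(-∞,0]` -/
noncomputable def wMeas (g : ℝ → ℝ) : Measure ℝ :=
  (volume.restrict (Set.Iic (0:ℝ))).withDensity (fun θ => ENNReal.ofReal (g θ))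

lemma g_aem (g : ℝ → ℝ) (hg_int : ∀ r : ℝ, 0 ≤ r → IntegrableOn g (Set.Icc (-r) 0)) :
    AEMeasurable g (volume.restrict (Set.Iic (0:ℝ))) := by
  have h : Set.Iic (0:ℝ) = ⋃ n : ℕ, Set.Icc (-(n:ℝ)) 0 := by
    ext x
    simp only [mem_Iic, mem_iUnion, mem_Icc]
    constructor
    · intro hx
      obtain ⟨n, hn⟩ := exists_nat_ge (-x)
      exact ⟨n, by linarith, hx⟩
    · rintro ⟨n, _, hx⟩
      exact hx
  rw [h, aemeasurable_iUnion_iff]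
  intro n
  exact (hg_int n (Nat.cast_nonneg n)).aemeasurable

lemma wMeas_lintegral (g : ℝ → ℝ)
    (hg_int : ∀ r : ℝ, 0 ≤ r → IntegrableOn g (Set.Icc (-r) 0))
    (F : ℝ → ENNReal) (hF : Measurable F) :
    ∫⁻ θ, F θ ∂(wMeas g) = ∫⁻ θ in Set.Iic (0:ℝ), ENNReal.ofReal (g θ) * F θ := by
  unfold wMeas
  rw [lintegral_withDensity_eq_lintegral_mul₀ (g_aem g hg_int).ennreal_ofReal hF.aemeasurable]
  rfl

lemma wMeas_Icc (g : ℝ → ℝ)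
    (hg_int : ∀ r : ℝ, 0 ≤ r → IntegrableOn g (Set.Icc (-r) 0)) (a b : ℝ) :
    wMeas g (Set.Icc a b) < ⊤ := by
  unfold wMeas
  rw [withDensity_apply _ measurableSet_Icc, Measure.restrict_restrict measurableSet_Icc]
  have h := (hg_int |a| (abs_nonneg a)).lintegral_lt_top
  refine lt_of_le_of_lt (lintegral_mono_set ?_) h
  rintro x ⟨hx, hx'⟩
  exact ⟨(neg_abs_le a).trans hx.1, hx'⟩

lemma wMeas_regular (g : ℝ → ℝ)
    (hg_int : ∀ r : ℝ, 0 ≤ r → IntegrableOn g (Set.Icc (-r) 0)) :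
    (wMeas g).Regular := by
  have : IsFiniteMeasureOnCompacts (wMeas g) := by
    refine ⟨fun K hK => ?_⟩
    obtain ⟨a, ha⟩ := hK.bddBelow
    obtain ⟨b, hb⟩ := hK.bddAbove
    exact lt_of_le_of_lt (measure_mono (show K ⊆ Icc a b from fun x hx => ⟨ha hx, hb hx⟩)) (wMeas_Icc g hg_int a b)
  have : IsLocallyFiniteMeasure (wMeas g) := isLocallyFiniteMeasure_of_isFiniteMeasureOnCompacts
  infer_instance

lemma wMeas_ae (g : ℝ → ℝ) : ∀ᵐ θ ∂(wMeas g), θ ≤ 0 :=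
  (withDensity_absolutelyContinuous _ _).ae_le (ae_restrict_mem measurableSet_Iic)

lemma wMeas_ne (g : ℝ → ℝ) (a : ℝ) : ∀ᵐ θ ∂(wMeas g), θ ≠ a := by
  refine (withDensity_absolutelyContinuous _ _).ae_le ?_
  exact ae_restrict_of_ae (Measure.ae_ne volume a)

lemma wMeas_shift (g G : ℝ → ℝ)
    (hg_pos : ∀ θ ≤ (0:ℝ), 0 < g θ)
    (hg_int : ∀ r : ℝ, 0 ≤ r → IntegrableOn g (Set.Icc (-r) 0))
    (hGg : ∀ s ≤ (0:ℝ),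
      ∀ᵐ θ ∂(volume.restrict (Set.Iic (0:ℝ))), g (s + θ) ≤ G s * g θ)
    (C s : ℝ) (hs : 0 ≤ s) (hC : G (-s) ≤ C)
    (F : ℝ → ENNReal) (hF : Measurable F) (hF0 : ∀ u, 0 < u → F u = 0) :
    ∫⁻ θ, F (s + θ) ∂(wMeas g) ≤ ENNReal.ofReal C * ∫⁻ θ, F θ ∂(wMeas g) := by
  rw [wMeas_lintegral g hg_int _ hF,
    wMeas_lintegral g hg_int (fun θ => F (s + θ)) (hF.comp (measurable_const_add s)),
    ← lintegral_indicator measurableSet_Iic, ← lintegral_indicator measurableSet_Iic,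
    ← lintegral_const_mul' _ _ ENNReal.ofReal_ne_top,
    ← lintegral_add_left_eq_self _ (-s)]
  refine lintegral_mono_ae ?_
  have h := hGg (-s) (by linarith)
  rw [ae_restrict_iff' measurableSet_Iic] at h
  filter_upwards [h] with u hu
  by_cases h0 : u ≤ 0
  · have hgu := hg_pos u h0
    rw [indicator_of_mem (show -s + u ∈ Iic 0 by simp; linarith),
      indicator_of_mem (show u ∈ Iic 0 from h0), add_neg_cancel_left, ← mul_assoc]
    gcongr
    have h1 := hu h0
    rw [← ENNReal.ofReal_mul' hgu.le]
    apply ENNReal.ofReal_le_ofReal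
    nlinarith
  · push Not at h0
    have : ((Iic (0:ℝ)).indicator (fun a => ENNReal.ofReal (g a) * F (s + a)) (-s + u)) = 0 := by
      apply indicator_apply_eq_zero.2
      intro _
      rw [add_neg_cancel_left, hF0 u h0, mul_zero]
    rw [this]
    exact zero_le

lemma wMeas_eLpNorm_shift {E : Type*} [NormedAddCommGroup E] (p : ℝ) (hp : 1 ≤ p) (g G : ℝ → ℝ)
    (hg_pos : ∀ θ ≤ (0:ℝ), 0 < g θ)
    (hg_int : ∀ r : ℝ, 0 ≤ r → IntegrableOn g (Set.Icc (-r) 0))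
    (hGg : ∀ s ≤ (0:ℝ),
      ∀ᵐ θ ∂(volume.restrict (Set.Iic (0:ℝ))), g (s + θ) ≤ G s * g θ)
    (C s : ℝ) (hs : 0 ≤ s) (hC : G (-s) ≤ C)
    (w : ℝ → E) (hw : StronglyMeasurable w) (hw0 : ∀ u, 0 < u → w u = 0) :
    eLpNorm (fun θ => w (s + θ)) (ENNReal.ofReal p) (wMeas g) ≤
      ENNReal.ofReal C ^ (1/p) * eLpNorm w (ENNReal.ofReal p) (wMeas g) := by
  have hp0 : ENNReal.ofReal p ≠ 0 := by simp; linarith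
  rw [eLpNorm_eq_lintegral_rpow_enorm_toReal hp0 ENNReal.ofReal_ne_top,
    eLpNorm_eq_lintegral_rpow_enorm_toReal hp0 ENNReal.ofReal_ne_top,
    ENNReal.toReal_ofReal (by linarith), ← ENNReal.mul_rpow_of_nonneg _ _ (by positivity)]
  refine ENNReal.rpow_le_rpow ?_ (by positivity)
  refine wMeas_shift g G hg_pos hg_int hGg C s hs hC (fun θ => ‖w θ‖ₑ ^ p)
    (hw.enorm.pow_const p) ?_
  intro u hu
  simp only [hw0 u hu, enorm_zero]
  exact ENNReal.zero_rpow_of_pos (by linarith)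

/-- the good part: dominated convergence -/
lemma wMeas_good {E : Type*} [NormedAddCommGroup E] (p : ℝ) (hp : 1 ≤ p) (g : ℝ → ℝ)
    (hg_int : ∀ r : ℝ, 0 ≤ r → IntegrableOn g (Set.Icc (-r) 0))
    (T : ℝ) (k : ℝ → E) (hk : StronglyMeasurable k)
    (hk0 : ∀ u < 0, ContinuousAt k u) (hk1 : ContinuousOn k (Ioc 0 T))
    (R M : ℝ) (hR : ∀ u < -R, k u = 0) (hM : ∀ u ≤ T, ‖k u‖ ≤ M)
    (t : ℝ) (ht : t ∈ Set.Icc 0 T) :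
    Tendsto (fun t' => eLpNorm (fun θ => k (t' + θ) - k (t + θ)) (ENNReal.ofReal p) (wMeas g))
      (𝓝[Set.Icc (0:ℝ) T] t) (𝓝 0) := by
  have hp0 : ENNReal.ofReal p ≠ 0 := by simp; linarith
  have hpp : 0 < p := by linarith
  simp only [eLpNorm_eq_lintegral_rpow_enorm_toReal hp0 ENNReal.ofReal_ne_top,
    ENNReal.toReal_ofReal hpp.le]
  have key : Tendsto (fun t' => ∫⁻ θ, ‖k (t' + θ) - k (t + θ)‖ₑ ^ p ∂(wMeas g))
      (𝓝[Set.Icc (0:ℝ) T] t) (𝓝 (∫⁻ _, 0 ∂(wMeas g))) := by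
    refine tendsto_lintegral_filter_of_dominated_convergence
      ((Icc (-R - T) 0).indicator fun _ => ENNReal.ofReal (M + M) ^ p) ?_ ?_ ?_ ?_
    · refine Eventually.of_forall fun t' => ?_
      exact (((hk.comp_measurable (measurable_const_add t')).sub
        (hk.comp_measurable (measurable_const_add t))).enorm.pow_const p)
    · filter_upwards [self_mem_nhdsWithin] with t' ht'
      filter_upwards [wMeas_ae g] with θ hθ
      by_cases h : -R - T ≤ θ
      · rw [indicator_of_mem (show θ ∈ Icc (-R - T) 0 from ⟨h, hθ⟩)]
        refine ENNReal.rpow_le_rpow ?_ hpp.le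
        rw [← ofReal_norm]
        apply ENNReal.ofReal_le_ofReal
        exact (norm_sub_le _ _).trans
          (add_le_add (hM _ (by linarith [ht'.2])) (hM _ (by linarith [ht.2])))
      · push Not at h
        rw [hR (t' + θ) (by linarith [ht'.2]), hR (t + θ) (by linarith [ht.2])]
        simp [hpp]
    · rw [lintegral_indicator measurableSet_Icc, setLIntegral_const]
      exact ENNReal.mul_ne_top (ENNReal.rpow_ne_top_of_nonneg hpp.le ENNReal.ofReal_ne_top)
        (wMeas_Icc g hg_int _ _).ne
    · filter_upwards [wMeas_ae g, wMeas_ne g (-t)] with θ hθ hθ'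
      have h1 : Tendsto (fun t' => k (t' + θ)) (𝓝[Set.Icc (0:ℝ) T] t) (𝓝 (k (t + θ))) := by
        have hc : Tendsto (fun t' : ℝ => t' + θ) (𝓝[Set.Icc (0:ℝ) T] t) (𝓝 (t + θ)) :=
          ((continuous_add_const θ).tendsto t).mono_left nhdsWithin_le_nhds
        rcases lt_or_gt_of_ne (show t + θ ≠ 0 from fun h => hθ' (by linarith)) with h | h
        · exact (hk0 _ h).tendsto.comp hc
        · have := hk1 (t + θ) ⟨h, by linarith [ht.2]⟩
          refine Tendsto.comp this (tendsto_nhdsWithin_iff.2 ⟨hc, ?_⟩)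
          filter_upwards [self_mem_nhdsWithin, hc.eventually (lt_mem_nhds h)] with t' ht' h'
          exact ⟨h', by linarith [ht'.2]⟩
      have h2 : Tendsto (fun t' => ‖k (t' + θ) - k (t + θ)‖ₑ) (𝓝[Set.Icc (0:ℝ) T] t) (𝓝 0) := by
        have := (h1.sub_const (k (t + θ))).enorm
        simpa using this
      have h3 := (ENNReal.continuous_rpow_const (y := p)).tendsto 0 |>.comp h2
      rw [ENNReal.zero_rpow_of_pos hpp] at h3
      exact h3
  rw [lintegral_zero] at key
  have h3 := (ENNReal.continuous_rpow_const (y := 1/p)).tendsto 0 |>.comp key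
  rw [ENNReal.zero_rpow_of_pos (by positivity)] at h3
  exact h3

lemma wMeas_main {E : Type*} [NormedAddCommGroup E] [NormedSpace ℝ E]
    (p : ℝ) (hp : 1 ≤ p)
    (g G : ℝ → ℝ)
    (hg_pos : ∀ θ ≤ (0:ℝ), 0 < g θ)
    (hg_int : ∀ r : ℝ, 0 ≤ r → IntegrableOn g (Set.Icc (-r) 0))
    (hG_locbdd : ∀ r : ℝ, 0 ≤ r → ∃ C : ℝ, ∀ s ∈ Set.Icc (-r) 0, G s ≤ C)
    (hGg : ∀ s ≤ (0:ℝ),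
      ∀ᵐ θ ∂(volume.restrict (Set.Iic (0:ℝ))), g (s + θ) ≤ G s * g θ)
    (T : ℝ) (hT : 0 < T)
    (φ : ℝ → E) (hφ_meas : StronglyMeasurable φ)
    (hφ_cont : ContinuousOn φ (Set.Icc 0 T))
    (hφ_init : MemLp φ (ENNReal.ofReal p) (wMeas g))
    (t : ℝ) (ht : t ∈ Set.Icc 0 T) :
    Tendsto (fun t' => eLpNorm (fun θ => φ (t' + θ) - φ (t + θ)) (ENNReal.ofReal p) (wMeas g))
      (𝓝[Set.Icc (0:ℝ) T] t) (𝓝 0) := by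
  have hreg := wMeas_regular g hg_int
  have hp1 : 1 ≤ ENNReal.ofReal p := by simpa using hp
  obtain ⟨C, hC⟩ := hG_locbdd T hT.le
  rw [ENNReal.tendsto_nhds_zero]
  intro ε hε
  set A : ENNReal := ENNReal.ofReal C ^ (1/p) with hA
  have hAt : A ≠ ⊤ := ENNReal.rpow_ne_top_of_nonneg (by positivity) ENNReal.ofReal_ne_top
  obtain ⟨δ, hδ, hδε⟩ : ∃ δ : ENNReal, δ ≠ 0 ∧ A * δ + A * δ ≤ ε / 2 := by
    have hc : Tendsto (fun δ : ENNReal => A * δ + A * δ) (𝓝[>] 0) (𝓝 (A * 0 + A * 0)) := by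
      have := (ENNReal.continuous_const_mul hAt).add (ENNReal.continuous_const_mul hAt)
      exact (this.tendsto 0).mono_left nhdsWithin_le_nhds
    simp only [mul_zero, add_zero] at hc
    have h2 := (hc.eventually (Iic_mem_nhds (ENNReal.half_pos hε.ne'))).and
      (self_mem_nhdsWithin (a := (0 : ENNReal)) (s := Ioi 0))
    obtain ⟨δ, h, h'⟩ := h2.exists
    exact ⟨δ, (ne_of_gt h'), h⟩
  obtain ⟨h, hsupp, hle, hcont, -⟩ :=
    hφ_init.exists_hasCompactSupport_eLpNorm_sub_le ENNReal.ofReal_ne_top hδ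
  set w : ℝ → E := (Iic (0:ℝ)).indicator (φ - h) with hw
  have hwm : StronglyMeasurable w :=
    (hφ_meas.sub hcont.stronglyMeasurable).indicator measurableSet_Iic
  have hwle : eLpNorm w (ENNReal.ofReal p) (wMeas g) ≤ δ := (eLpNorm_indicator_le _).trans hle
  have hw0 : ∀ u, 0 < u → w u = 0 := fun u hu => indicator_of_notMem (by simpa using hu) _
  set k : ℝ → E := φ - w with hk
  have hkm : StronglyMeasurable k := hφ_meas.sub hwm
  have hkl : ∀ u ≤ 0, k u = h u := by
    intro u hu
    simp [hk, hw, indicator_of_mem (show u ∈ Iic (0:ℝ) from hu)]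
  have hkr : ∀ u, 0 < u → k u = φ u := by
    intro u hu
    simp [hk, hw0 u hu]
  obtain ⟨M1, hM1⟩ := hsupp.exists_bound_of_continuous hcont
  obtain ⟨M2, hM2⟩ := isCompact_Icc.exists_bound_of_continuousOn hφ_cont
  obtain ⟨b, hb⟩ := hsupp.isCompact.bddBelow
  have hgood := wMeas_good p hp g hg_int T k hkm ?_ ?_ (max (-b) 0) (max M1 M2) ?_ ?_ t ht
  · have hs : ∀ s ∈ Icc 0 T, eLpNorm (fun θ => w (s + θ)) (ENNReal.ofReal p) (wMeas g) ≤ A * δ := by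
      intro s hs
      refine (wMeas_eLpNorm_shift p hp g G hg_pos hg_int hGg C s hs.1
        (hC _ ⟨by linarith [hs.2], by linarith [hs.1]⟩) w hwm hw0).trans ?_
      gcongr
    have hsm : ∀ {f : ℝ → E} (_ : StronglyMeasurable f) (s : ℝ),
        AEStronglyMeasurable (fun θ => f (s + θ)) (wMeas g) := fun hf s =>
      (hf.comp_measurable (measurable_const_add s)).aestronglyMeasurable
    filter_upwards [self_mem_nhdsWithin, ENNReal.tendsto_nhds_zero.1 hgood (ε / 2)
      (ENNReal.half_pos hε.ne')] with t' ht' hkt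
    have hdec : (fun θ => φ (t' + θ) - φ (t + θ)) =
        ((fun θ => w (t' + θ)) - (fun θ => w (t + θ))) +
          (fun θ => k (t' + θ) - k (t + θ)) := by
      funext θ
      simp only [hk, Pi.add_apply, Pi.sub_apply]
      abel
    rw [hdec]
    refine (eLpNorm_add_le ((hsm hwm t').sub (hsm hwm t)) ((hsm hkm t').sub (hsm hkm t)) hp1).trans ?_
    refine (add_le_add ((eLpNorm_sub_le (hsm hwm t') (hsm hwm t) hp1).trans
      (add_le_add (hs t' ht') (hs t ht))) hkt).trans ?_
    refine (add_le_add hδε le_rfl).trans ?_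
    rw [ENNReal.add_halves]
  · intro u hu
    refine hcont.continuousAt.congr ?_
    filter_upwards [gt_mem_nhds hu] with x hx
    exact (hkl x hx.le).symm
  · refine (hφ_cont.mono Ioc_subset_Icc_self).congr ?_
    intro x hx
    exact hkr x hx.1
  · intro u hu
    have h1 := le_max_left (-b) 0
    have h2 := le_max_right (-b) 0
    rw [hkl u (by linarith)]
    by_contra hne
    have h3 := hb (subset_tsupport _ hne)
    linarith
  · intro u hu
    by_cases h0 : u ≤ 0
    · rw [hkl u h0]
      exact (hM1 u).trans (le_max_left _ _)
    · push Not at h0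
      rw [hkr u h0]
      exact (hM2 u ⟨h0.le, hu⟩).trans (le_max_right _ _)

/-- If `φ : (-∞,T] → E` is strongly measurable, continuous on `[0,T]`, and
`(φ₀, φ(0)) ∈ ℬ = L^p_g(-∞,0;E) × E`, then `t ↦ (φ_t, φ(t))` is continuous from `[0,T]`
into `(ℬ, ‖·‖_ℬ)`: for every `t ∈ [0,T]` the `ℬ`-distance
`‖φ(t') - φ(t)‖ + (∫_{-∞}^0 g(θ)‖φ(t'+θ) - φ(t+θ)‖^p dθ)^{1/p}` tends to `0` as `t' → t`
within `[0,T]`; in particular `∫_{-∞}^0 g(θ)‖φ(t'+θ) - φ(t+θ)‖^p dθ → 0`. -/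
theorem history_map_continuous
    {E : Type*} [NormedAddCommGroup E] [NormedSpace ℝ E] [CompleteSpace E]
    (p : ℝ) (hp : 1 ≤ p)
    (g G : ℝ → ℝ)
    (hg_pos : ∀ θ ≤ (0:ℝ), 0 < g θ)
    (hg_int : ∀ r : ℝ, 0 ≤ r → IntegrableOn g (Set.Icc (-r) 0))
    (hG_nonneg : ∀ s ≤ (0:ℝ), 0 ≤ G s)
    (hG_locbdd : ∀ r : ℝ, 0 ≤ r → ∃ C : ℝ, ∀ s ∈ Set.Icc (-r) 0, G s ≤ C)
    (hGg : ∀ s ≤ (0:ℝ),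
      ∀ᵐ θ ∂(volume.restrict (Set.Iic (0:ℝ))), g (s + θ) ≤ G s * g θ)
    (T : ℝ) (hT : 0 < T)
    (φ : ℝ → E) (hφ_meas : StronglyMeasurable φ)
    (hφ_cont : ContinuousOn φ (Set.Icc 0 T))
    (hφ_init : IntegrableOn (fun θ => g θ * ‖φ θ‖ ^ p) (Set.Iic (0:ℝ)))
    (t : ℝ) (ht : t ∈ Set.Icc 0 T) :
    Tendsto
      (fun t' => ‖φ t' - φ t‖ +
        (∫ θ in Set.Iic (0:ℝ), g θ * ‖φ (t' + θ) - φ (t + θ)‖ ^ p) ^ (1/p))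
      (𝓝[Set.Icc (0:ℝ) T] t) (𝓝 0) ∧
    Tendsto
      (fun t' => ∫ θ in Set.Iic (0:ℝ), g θ * ‖φ (t' + θ) - φ (t + θ)‖ ^ p)
      (𝓝[Set.Icc (0:ℝ) T] t) (𝓝 0) := by
  have hpp : 0 < p := by linarith
  have hp0 : ENNReal.ofReal p ≠ 0 := by simp; linarith
  have hof : ∀ θ ≤ (0:ℝ), ∀ x : E, ENNReal.ofReal (g θ * ‖x‖ ^ p) =
      ENNReal.ofReal (g θ) * ‖x‖ₑ ^ p := by
    intro θ hθ x
    rw [ENNReal.ofReal_mul (hg_pos θ hθ).le, ← ENNReal.ofReal_rpow_of_nonneg (norm_nonneg _) hpp.le,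
      ofReal_norm]
  have hconv : ∀ f : ℝ → E, StronglyMeasurable f →
      ∫⁻ θ in Set.Iic (0:ℝ), ENNReal.ofReal (g θ * ‖f θ‖ ^ p) =
        eLpNorm f (ENNReal.ofReal p) (wMeas g) ^ p := by
    intro f hf
    rw [eLpNorm_eq_lintegral_rpow_enorm_toReal hp0 ENNReal.ofReal_ne_top,
      ENNReal.toReal_ofReal hpp.le, ← ENNReal.rpow_mul, one_div_mul_cancel hpp.ne',
      ENNReal.rpow_one, wMeas_lintegral g hg_int _ (hf.enorm.pow_const p)]
    exact setLIntegral_congr_fun measurableSet_Iic fun θ hθ => hof θ hθ _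
  have hmem : MemLp φ (ENNReal.ofReal p) (wMeas g) := by
    refine ⟨hφ_meas.aestronglyMeasurable, ?_⟩
    have h := hφ_init.lintegral_lt_top
    rw [hconv φ hφ_meas] at h
    by_contra hne
    rw [not_lt, top_le_iff] at hne
    rw [hne, ENNReal.top_rpow_of_pos hpp] at h
    exact lt_irrefl _ h
  have hmain := wMeas_main p hp g G hg_pos hg_int hG_locbdd hGg T hT φ hφ_meas hφ_cont hmem t ht
  have h2 : Tendsto
      (fun t' => ∫ θ in Set.Iic (0:ℝ), g θ * ‖φ (t' + θ) - φ (t + θ)‖ ^ p)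
      (𝓝[Set.Icc (0:ℝ) T] t) (𝓝 0) := by
    have heq : ∀ t', ∫ θ in Set.Iic (0:ℝ), g θ * ‖φ (t' + θ) - φ (t + θ)‖ ^ p =
        (eLpNorm (fun θ => φ (t' + θ) - φ (t + θ)) (ENNReal.ofReal p) (wMeas g) ^ p).toReal := by
      intro t'
      have hsm : StronglyMeasurable (fun θ => φ (t' + θ) - φ (t + θ)) :=
        (hφ_meas.comp_measurable (measurable_const_add t')).sub
          (hφ_meas.comp_measurable (measurable_const_add t))
      rw [← hconv _ hsm, integral_eq_lintegral_of_nonneg_ae]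
      · filter_upwards [ae_restrict_mem measurableSet_Iic] with θ hθ
        exact mul_nonneg (hg_pos θ hθ).le (by positivity)
      · exact ((g_aem g hg_int).mul
          (hsm.norm.measurable.pow_const p).aemeasurable).aestronglyMeasurable
    simp only [heq]
    have h3 := (ENNReal.continuous_rpow_const (y := p)).tendsto 0 |>.comp hmain
    rw [ENNReal.zero_rpow_of_pos hpp] at h3
    exact (ENNReal.tendsto_toReal ENNReal.zero_ne_top).comp h3
  refine ⟨?_, h2⟩
  have h4 : Tendsto (fun t' => ‖φ t' - φ t‖) (𝓝[Set.Icc (0:ℝ) T] t) (𝓝 0) := by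
    have := ((hφ_cont t ht).tendsto.sub_const (φ t)).norm
    simpa using this
  have h5 := h2.rpow_const (p := 1/p) (Or.inr (by positivity))
  rw [Real.zero_rpow (by positivity)] at h5
  simpa using h4.add h5
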